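/- Let f: Ω → ℝ be α-Hölder with λ > 0 and strictly positive α-Hölder h satisfying L_f h = λ h. Then the variational principle for the specific entropy holds: log λ = sup { h^s(μ) + ∫_Ω f dμ : μ shift-invariant Borel probability measure on Ω }. -/

import Mathlib

open MeasureTheory Filter
open scoped Classical

noncomputable section

namespace Paper

variable {A : Type*} [MetricSpace A] [CompactSpace A] [MeasurableSpace A] [BorelSpace A]

/-- The left shift `σ` on `Ω = Aᴺ`. -/
def shift (x : ℕ → A) : ℕ → A := fun n => x (n + 1)

/-- Prepend a symbol: `cons a x = (a, x₀, x₁, …)`. -/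
def cons (a : A) (x : ℕ → A) : ℕ → A := fun n =>
  match n with
  | 0 => a
  | n + 1 => x n

/-- The metric `d_Ω` on `Ω`. -/
def dOmega (x y : ℕ → A) : ℝ :=
  ∑' n : ℕ, (1 / 2 : ℝ) ^ (n + 1) * (dist (x n) (y n) / (1 + dist (x n) (y n)))

/-- `f` is `α`-Hölder with respect to `d_Ω`. -/
def IsHolder (α : ℝ) (f : (ℕ → A) → ℝ) : Prop :=
  ∃ C : ℝ, 0 ≤ C ∧ ∀ x y, |f x - f y| ≤ C * dOmega x y ^ α

/-- The Ruelle transfer operator with a priori measure `p`. -/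
def ruelle (p : Measure A) (f φ : (ℕ → A) → ℝ) : (ℕ → A) → ℝ :=
  fun x => ∫ a, Real.exp (f (cons a x)) * φ (cons a x) ∂p

/-- The normalized potential `f̄ = f + log h - log (h ∘ σ) - log λ`. -/
def fbar (f h : (ℕ → A) → ℝ) (lam : ℝ) : (ℕ → A) → ℝ :=
  fun x => f x + Real.log (h x) - Real.log (h (shift x)) - Real.log lam

/-- Projection on the first `n` coordinates. -/
def proj (n : ℕ) (x : ℕ → A) : Fin n → A := fun i => x i

/-- Relative entropy `H(μ|ν)` of two measures, with value `+∞` unless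
`μ ≪ ν` and the entropy integral is finite. -/
def relEnt {X : Type*} [MeasurableSpace X] (μ ν : Measure X) : EReal :=
  if μ ≪ ν ∧ Integrable (fun x => Real.log (μ.rnDeriv ν x).toReal) μ then
    ((∫ x, Real.log (μ.rnDeriv ν x).toReal ∂μ : ℝ) : EReal)
  else ⊤

/-- Relative entropy `H_{Λ_n}(μ|ν)` on the σ-algebra of the first `n` coordinates. -/
def relEntN (n : ℕ) (μ ν : Measure (ℕ → A)) : EReal :=
  relEnt (μ.map (proj n)) (ν.map (proj n))

/-- The entropy `H_{Λ_n}(μ) = -H_{Λ_n}(μ | pᴺ)` relative to the a priori measure `p`. -/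
def finEnt (p : Measure A) (μ : Measure (ℕ → A)) (n : ℕ) : EReal :=
  - relEnt (μ.map (proj n)) (Measure.pi fun _ : Fin n => p)

/-- The specific entropy `h^s(μ) = lim_n H_{Λ_n}(μ)/n` (defined as a `limsup`,
which coincides with the limit whenever the latter exists). -/
def specEnt (p : Measure A) (μ : Measure (ℕ → A)) : EReal :=
  Filter.atTop.limsup fun n : ℕ => ((n : ℝ)⁻¹ : EReal) * finEnt p μ n

/-- Birkhoff sum `S_n(f)`. -/
def birkhoff (n : ℕ) (f : (ℕ → A) → ℝ) (x : ℕ → A) : ℝ :=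
  ∑ i ∈ Finset.range n, f (shift^[i] x)

/-- The configuration `x_{Λ_n} y_{Λ_n^c}`. -/
def concatAt (n : ℕ) (x y : ℕ → A) : ℕ → A := fun i => if i < n then x i else y i

/-- Concatenation of a finite word with a configuration. -/
def wordCons (n : ℕ) (a : Fin n → A) (x : ℕ → A) : ℕ → A :=
  fun i => if h : i < n then a ⟨i, h⟩ else x (i - n)

theorem iterate_apply_mem_Icc {X : Type*} [TopologicalSpace X] [CompactSpace X]
    (L : C(X, ℝ) →ₗ[ℝ] C(X, ℝ)) (hL : ∀ φ, 0 ≤ φ → 0 ≤ L φ) (h1 : L 1 = 1)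
    (φ : C(X, ℝ)) (x : X) (n : ℕ) : (L^[n] φ) x ∈ Set.Icc (-‖φ‖) ‖φ‖ := by
  have key : ∀ n (φ : C(X, ℝ)) (c : ℝ), (∀ x, |φ x| ≤ c) → ∀ x, |(L^[n] φ) x| ≤ c := by
    intro n
    induction n with
    | zero => intro φ c hc x; simpa using hc x
    | succ k ih =>
      intro φ c hc x
      rw [Function.iterate_succ_apply]
      refine ih _ _ (fun y => ?_) x
      have a1 := hL (c • 1 - φ) (fun z => by simpa using (abs_le.1 (hc z)).2)
      have a2 := hL (c • 1 + φ) (fun z => by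
        have := (abs_le.1 (hc z)).1
        simp; linarith)
      rw [map_sub, map_smul, h1] at a1
      rw [map_add, map_smul, h1] at a2
      have b1 := a1 y
      have b2 := a2 y
      simp at b1 b2
      rw [abs_le]
      constructor <;> linarith
  exact abs_le.1 (key n φ _ (fun y => φ.norm_coe_le_norm y) x)

/-- **Krylov–Bogoliubov** for Markov operators on a compact space: a positive unital operator
on `C(X, ℝ)` has an invariant probability measure. -/
theorem exists_invariant_probabilityMeasure {X : Type*} [TopologicalSpace X] [CompactSpace X]
    [T2Space X] [MeasurableSpace X] [BorelSpace X] [Nonempty X]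
    (L : C(X, ℝ) →ₗ[ℝ] C(X, ℝ)) (hL : ∀ φ, 0 ≤ φ → 0 ≤ L φ) (h1 : L 1 = 1) :
    ∃ μ : Measure X, IsProbabilityMeasure μ ∧ ∀ φ : C(X, ℝ), ∫ x, L φ x ∂μ = ∫ x, φ x ∂μ := by
  obtain ⟨x₀⟩ := ‹Nonempty X›
  let avg : C(X, ℝ) → ℕ → ℝ := fun φ N =>
    ((N : ℝ) + 1)⁻¹ * ∑ n ∈ Finset.range (N + 1), (L^[n] φ) x₀
  have iter_add : ∀ n φ ψ, L^[n] (φ + ψ) = L^[n] φ + L^[n] ψ := fun n φ ψ => by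
    simp only [← Module.End.pow_apply, map_add]
  have iter_smul : ∀ n (c : ℝ) φ, L^[n] (c • φ) = c • L^[n] φ := fun n c φ => by
    simp only [← Module.End.pow_apply, map_smul]
  have avg_mem : ∀ φ N, avg φ N ∈ Set.Icc (-‖φ‖) ‖φ‖ := by
    intro φ N
    have hN : (0 : ℝ) < (N : ℝ) + 1 := by positivity
    have hb := fun n => iterate_apply_mem_Icc L hL h1 φ x₀ n
    constructor
    · rw [le_inv_mul_iff₀ hN]
      have := Finset.card_nsmul_le_sum (Finset.range (N + 1)) (fun n => (L^[n] φ) x₀) (-‖φ‖)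
        (fun n _ => (hb n).1)
      simpa using this
    · rw [inv_mul_le_iff₀ hN]
      have := Finset.sum_le_card_nsmul (Finset.range (N + 1)) (fun n => (L^[n] φ) x₀) (‖φ‖)
        (fun n _ => (hb n).2)
      simpa using this
  have hlim : ∀ φ, ∃ l, Tendsto (avg φ) (hyperfilter ℕ) (nhds l) := by
    intro φ
    obtain ⟨l, -, hl⟩ := isCompact_Icc.ultrafilter_le_nhds' ((hyperfilter ℕ).map (avg φ))
      (Filter.mem_map.2 (Filter.univ_mem' (avg_mem φ)))
    exact ⟨l, hl⟩
  choose Λ hΛ using hlim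
  have Λ_add : ∀ φ ψ, Λ (φ + ψ) = Λ φ + Λ ψ := fun φ ψ => by
    refine tendsto_nhds_unique (hΛ _) (((hΛ φ).add (hΛ ψ)).congr fun N => ?_)
    simp only [avg, iter_add, ContinuousMap.add_apply, Finset.sum_add_distrib, mul_add]
  have Λ_smul : ∀ (c : ℝ) φ, Λ (c • φ) = c • Λ φ := fun c φ => by
    refine tendsto_nhds_unique (hΛ _) (((hΛ φ).const_mul c).congr fun N => ?_)
    simp only [avg, iter_smul, ContinuousMap.smul_apply, smul_eq_mul, ← Finset.mul_sum]
    ring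
  have Λ_nonneg : ∀ φ, 0 ≤ φ → 0 ≤ Λ φ := fun φ hφ => by
    have hit : ∀ n, 0 ≤ L^[n] φ := fun n => by
      induction n with
      | zero => exact hφ
      | succ k ih => rw [Function.iterate_succ_apply']; exact hL _ ih
    refine ge_of_tendsto' (hΛ φ) fun N => ?_
    exact mul_nonneg (by positivity) (Finset.sum_nonneg fun n _ => hit n x₀)
  have Λ_one : Λ 1 = 1 := by
    refine tendsto_nhds_unique (hΛ _) (tendsto_const_nhds.congr fun N => ?_)
    have hit : ∀ n, L^[n] 1 = 1 := fun n => Function.iterate_fixed h1 n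
    have hN : ((N : ℝ) + 1) ≠ 0 := by positivity
    simp [avg, hit, hN]
  have Λ_inv : ∀ φ, Λ (L φ) = Λ φ := fun φ => by
    rw [← sub_eq_zero]
    refine tendsto_nhds_unique ((hΛ (L φ)).sub (hΛ φ))
      (Tendsto.mono_left ?_ Nat.hyperfilter_le_atTop)
    have hz : Tendsto (fun N : ℕ => (1 / ((N : ℝ) + 1)) * (2 * ‖φ‖)) atTop (nhds 0) := by
      simpa using tendsto_one_div_add_atTop_nhds_zero_nat.mul_const (2 * ‖φ‖)
    refine squeeze_zero_norm (fun N => ?_) hz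
    have : avg (L φ) N - avg φ N = (1 / ((N : ℝ) + 1)) * ((L^[N + 1] φ) x₀ - φ x₀) := by
      simp only [avg, ← Function.iterate_succ_apply, ← mul_sub, ← Finset.sum_sub_distrib, one_div]
      rw [Finset.sum_range_sub (fun n => (L^[n] φ) x₀)]
      simp
    rw [this, norm_mul, Real.norm_of_nonneg (by positivity)]
    refine mul_le_mul_of_nonneg_left ?_ (by positivity)
    have b1 := iterate_apply_mem_Icc L hL h1 φ x₀ (N + 1)
    have b2 := iterate_apply_mem_Icc L hL h1 φ x₀ 0
    simp only [Function.iterate_zero, id] at b2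
    rw [Real.norm_eq_abs, abs_le]
    constructor <;> linarith [b1.1, b1.2, b2.1, b2.2]
  let Λc : CompactlySupportedContinuousMap X ℝ →ₚ[ℝ] ℝ := PositiveLinearMap.mk₀
    { toFun := fun φ => Λ (φ : C(X, ℝ))
      map_add' := fun φ ψ => Λ_add φ ψ
      map_smul' := fun c φ => Λ_smul c φ }
    (fun φ hφ => Λ_nonneg φ hφ)
  have hint : ∀ φ : C(X, ℝ), ∫ x, φ x ∂(RealRMK.rieszMeasure Λc) = Λ φ := fun φ =>
    RealRMK.integral_rieszMeasure Λc (CompactlySupportedContinuousMap.continuousMapEquiv φ)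
  refine ⟨RealRMK.rieszMeasure Λc, ⟨?_⟩, fun φ => by rw [hint, hint, Λ_inv]⟩
  have := hint 1
  rw [Λ_one] at this
  simpa [Measure.real, ENNReal.toReal_eq_one_iff] using this

omit [MetricSpace A] [CompactSpace A] [MeasurableSpace A] [BorelSpace A] in
theorem shift_cons (a : A) (x : ℕ → A) : shift (cons a x) = x := rfl

omit [CompactSpace A] [MeasurableSpace A] [BorelSpace A] in
theorem continuous_shift : Continuous (shift : (ℕ → A) → ℕ → A) :=
  continuous_pi fun n => continuous_apply (n + 1)

omit [CompactSpace A] [MeasurableSpace A] [BorelSpace A] in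
theorem continuous_cons : Continuous fun q : A × (ℕ → A) => cons q.1 q.2 :=
  continuous_pi fun n => by
    cases n with
    | zero => exact continuous_fst
    | succ n => exact (continuous_apply n).comp continuous_snd

omit [CompactSpace A] [MeasurableSpace A] [BorelSpace A] in
theorem continuous_proj (n : ℕ) : Continuous (proj n : (ℕ → A) → Fin n → A) :=
  continuous_pi fun i => continuous_apply (i : ℕ)

omit [CompactSpace A] [MeasurableSpace A] [BorelSpace A] in
theorem continuous_wordCons (n : ℕ) :
    Continuous fun q : (Fin n → A) × (ℕ → A) => wordCons n q.1 q.2 :=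
  continuous_pi fun i => by
    by_cases hi : i < n
    · simp only [wordCons, hi, dite_true]
      exact (continuous_apply _).comp continuous_fst
    · simp only [wordCons, hi, dite_false]
      exact (continuous_apply _).comp continuous_snd

omit [MetricSpace A] [CompactSpace A] [MeasurableSpace A] [BorelSpace A] in
theorem proj_wordCons (n : ℕ) (a : Fin n → A) (y : ℕ → A) : proj n (wordCons n a y) = a := by
  funext i
  simp [proj, wordCons]

omit [MetricSpace A] [CompactSpace A] [MeasurableSpace A] [BorelSpace A] in
theorem wordCons_proj_apply {n i : ℕ} (hi : i < n) (x y : ℕ → A) :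
    wordCons n (proj n x) y i = x i := by
  simp [wordCons, proj, hi]

omit [MetricSpace A] [CompactSpace A] [MeasurableSpace A] [BorelSpace A] in
theorem wordCons_zero (a : Fin 0 → A) (y : ℕ → A) : wordCons 0 a y = y := by
  funext i
  simp [wordCons]

omit [MetricSpace A] [CompactSpace A] [MeasurableSpace A] [BorelSpace A] in
theorem wordCons_finCons (n : ℕ) (b : A) (a : Fin n → A) (y : ℕ → A) :
    wordCons (n + 1) (Fin.cons b a : Fin (n + 1) → A) y = cons b (wordCons n a y) := by
  funext i
  cases i with
  | zero => simp [wordCons, cons]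
  | succ i =>
    by_cases hi : i < n
    · have : (⟨i + 1, by omega⟩ : Fin (n + 1)) = Fin.succ ⟨i, hi⟩ := rfl
      simp only [wordCons, cons, hi, Nat.add_lt_add_iff_right, dite_true]
      rw [this, Fin.cons_succ]
    · simp [wordCons, cons, hi]

omit [MetricSpace A] [CompactSpace A] [MeasurableSpace A] [BorelSpace A] in
theorem birkhoff_succ_cons (n : ℕ) (ψ : (ℕ → A) → ℝ) (b : A) (x : ℕ → A) :
    birkhoff (n + 1) ψ (cons b x) = ψ (cons b x) + birkhoff n ψ x := by
  simp only [birkhoff, Finset.sum_range_succ', Function.iterate_succ_apply, shift_cons,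
    Function.iterate_zero, id]
  ring

omit [CompactSpace A] [MeasurableSpace A] [BorelSpace A] in
theorem continuous_birkhoff (n : ℕ) {ψ : (ℕ → A) → ℝ} (hψ : Continuous ψ) :
    Continuous (birkhoff n ψ) :=
  continuous_finsetSum _ fun i _ => hψ.comp (continuous_shift.iterate i)

theorem continuous_ruelle (p : Measure A) [IsProbabilityMeasure p] {ψ φ : (ℕ → A) → ℝ}
    (hψ : Continuous ψ) (hφ : Continuous φ) : Continuous (ruelle p ψ φ) := by
  have hc : Continuous fun q : (ℕ → A) × A => cons q.2 q.1 := continuous_cons.comp continuous_swap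
  have : Continuous (Function.uncurry fun (x : ℕ → A) (a : A) =>
      Real.exp (ψ (cons a x)) * φ (cons a x)) :=
    (Real.continuous_exp.comp (hψ.comp hc)).mul (hφ.comp hc)
  have hint := continuous_parametric_integral_of_continuous (μ := p) this isCompact_univ
  rwa [Measure.restrict_univ] at hint

theorem integrable_of_continuous {X : Type*} [TopologicalSpace X] [CompactSpace X]
    [MeasurableSpace X] [BorelSpace X] (μ : Measure X) [IsFiniteMeasure μ]
    {φ : X → ℝ} (hφ : Continuous φ) : Integrable φ μ :=
  hφ.integrable_of_hasCompactSupport (HasCompactSupport.of_compactSpace φ)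

theorem integral_pi_succ (p : Measure A) [IsProbabilityMeasure p] (n : ℕ)
    {F : (Fin (n + 1) → A) → ℝ} (hF : Continuous F) :
    ∫ w, F w ∂(Measure.pi fun _ => p)
      = ∫ a, ∫ b, F (Fin.cons b a : Fin (n + 1) → A) ∂p ∂(Measure.pi fun _ : Fin n => p) := by
  have hc : Continuous fun q : A × (Fin n → A) => (Fin.cons q.1 q.2 : Fin (n + 1) → A) :=
    continuous_pi fun i => by
      refine Fin.cases ?_ (fun j => ?_) i
      · simpa using continuous_fst
      · simp only [Fin.cons_succ]
        exact (continuous_apply j).comp continuous_snd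
  rw [← ((measurePreserving_piFinSuccAbove (fun _ => p) 0).symm).integral_comp']
  rw [integral_prod_symm]
  · simp [MeasurableEquiv.piFinSuccAbove_symm_apply, Fin.insertNthEquiv]
  · simpa [MeasurableEquiv.piFinSuccAbove_symm_apply, Fin.insertNthEquiv, Function.comp_def] using
      integrable_of_continuous (p.prod (Measure.pi fun _ : Fin n => p)) (hF.comp hc)

theorem ruelle_iterate (p : Measure A) [IsProbabilityMeasure p] {ψ : (ℕ → A) → ℝ}
    (hψ : Continuous ψ) (n : ℕ) {φ : (ℕ → A) → ℝ} (hφ : Continuous φ) (y : ℕ → A) :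
    ((ruelle p ψ)^[n] φ) y = ∫ a, Real.exp (birkhoff n ψ (wordCons n a y)) *
      φ (wordCons n a y) ∂(Measure.pi fun _ : Fin n => p) := by
  induction n generalizing φ with
  | zero => simp [birkhoff, wordCons_zero]
  | succ n ih =>
    rw [Function.iterate_succ_apply, ih (continuous_ruelle p hψ hφ), integral_pi_succ]
    · refine integral_congr_ae (ae_of_all _ fun a => ?_)
      simp only [ruelle, wordCons_finCons, birkhoff_succ_cons, ← integral_const_mul]
      refine integral_congr_ae (ae_of_all _ fun b => ?_)
      simp only [Real.exp_add]
      ring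
    · have hc : Continuous fun a => wordCons (n + 1) a y :=
        (continuous_wordCons (n + 1)).comp (continuous_id.prodMk continuous_const)
      exact (Real.continuous_exp.comp ((continuous_birkhoff _ hψ).comp hc)).mul (hφ.comp hc)

theorem integral_birkhoff {μ : Measure (ℕ → A)} [IsProbabilityMeasure μ]
    (hμ : μ.map shift = μ) {ψ : (ℕ → A) → ℝ} (hψ : Continuous ψ) (n : ℕ) :
    ∫ x, birkhoff n ψ x ∂μ = n * ∫ x, ψ x ∂μ := by
  have hmp : MeasurePreserving shift μ μ := ⟨continuous_shift.measurable, hμ⟩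
  have hi : ∀ i, ∫ x, ψ (shift^[i] x) ∂μ = ∫ x, ψ x ∂μ := fun i => by
    have h' := (hmp.iterate i).map_eq
    conv_rhs => rw [← h']
    rw [integral_map (hmp.iterate i).measurable.aemeasurable hψ.aestronglyMeasurable]
  simp only [birkhoff]
  rw [integral_finsetSum _ fun i _ => show Integrable (fun x => ψ (shift^[i] x)) μ from
    integrable_of_continuous μ (hψ.comp (continuous_shift.iterate i))]
  simp [hi]

/-- Gibbs' inequality against a density `exp g` of total mass one. -/
theorem le_relEnt {X : Type*} [MeasurableSpace X] (μ ν : Measure X) [IsProbabilityMeasure μ]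
    [IsProbabilityMeasure ν] {g : X → ℝ} (hgμ : Integrable g μ)
    (hgν : Integrable (fun x => Real.exp (g x)) ν) (hg : ∫ x, Real.exp (g x) ∂ν = 1) :
    ((∫ x, g x ∂μ : ℝ) : EReal) ≤ relEnt μ ν := by
  unfold relEnt
  split_ifs with hc
  · obtain ⟨hac, hint⟩ := hc
    have hl : Integrable (llr μ ν) μ := hint
    have e1 := integral_llr_tilted_right hac hgμ hgν hl
    have : IsProbabilityMeasure (ν.tilted g) := isProbabilityMeasure_tilted hgν
    have hac' : μ ≪ ν.tilted g := hac.trans (absolutelyContinuous_tilted hgν)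
    have e2 := InformationTheory.integral_llr_add_sub_measure_univ_nonneg hac'
      (integrable_llr_tilted_right hac hgμ hl hgν)
    rw [e1, hg] at e2
    simp at e2
    exact EReal.coe_le_coe_iff.2 e2
  · exact le_top

/-- The entropy of a measure with a continuous positive density. -/
theorem relEnt_withDensity {X : Type*} [TopologicalSpace X] [CompactSpace X] [MeasurableSpace X]
    [BorelSpace X] (ν : Measure X) [IsProbabilityMeasure ν] {ρ : X → ℝ} (hρ : Continuous ρ)
    (hpos : ∀ x, 0 < ρ x) {μ : Measure X} [IsProbabilityMeasure μ]
    (hμ : μ = ν.withDensity fun x => ENNReal.ofReal (ρ x)) :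
    relEnt μ ν = ((∫ x, Real.log (ρ x) ∂μ : ℝ) : EReal) := by
  have hac : μ ≪ ν := hμ ▸ withDensity_absolutelyContinuous _ _
  have hrn : μ.rnDeriv ν =ᵐ[ν] fun x => ENNReal.ofReal (ρ x) := by
    rw [hμ]
    exact Measure.rnDeriv_withDensity ν hρ.measurable.ennreal_ofReal
  have hlog : (fun x => Real.log (μ.rnDeriv ν x).toReal) =ᵐ[μ] fun x => Real.log (ρ x) := by
    filter_upwards [hac.ae_le hrn] with x hx
    rw [hx, ENNReal.toReal_ofReal (hpos x).le]
  have hint : Integrable (fun x => Real.log (ρ x)) μ :=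
    integrable_of_continuous μ (hρ.log fun x => (hpos x).ne')
  unfold relEnt
  rw [if_pos ⟨hac, hint.congr hlog.symm⟩, integral_congr_ae hlog]

/-- A normalized potential admits a shift-invariant probability measure fixed by the dual of
its Ruelle operator. -/
theorem exists_dual_fixed (p : Measure A) [IsProbabilityMeasure p] {ψ : (ℕ → A) → ℝ}
    (hψ : Continuous ψ) (h1 : ∀ x, ruelle p ψ (fun _ => 1) x = 1) :
    ∃ μ : Measure (ℕ → A), IsProbabilityMeasure μ ∧ μ.map shift = μ ∧
      ∀ φ : (ℕ → A) → ℝ, Continuous φ → ∫ x, ruelle p ψ φ x ∂μ = ∫ x, φ x ∂μ := by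
  have hA : Nonempty A := nonempty_of_isProbabilityMeasure p
  have hint : ∀ (φ : C(ℕ → A, ℝ)) x,
      Integrable (fun a => Real.exp (ψ (cons a x)) * φ (cons a x)) p := fun φ x => by
    have hc : Continuous fun a => cons a x :=
      continuous_cons.comp (continuous_id.prodMk continuous_const)
    exact integrable_of_continuous p
      ((Real.continuous_exp.comp (hψ.comp hc)).mul (φ.continuous.comp hc))
  let L : C(ℕ → A, ℝ) →ₗ[ℝ] C(ℕ → A, ℝ) :=
    { toFun := fun φ => ⟨ruelle p ψ φ, continuous_ruelle p hψ φ.continuous⟩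
      map_add' := fun φ₁ φ₂ => by
        ext x
        simp only [ruelle, ContinuousMap.coe_mk, ContinuousMap.add_apply, mul_add]
        exact integral_add (hint φ₁ x) (hint φ₂ x)
      map_smul' := fun c φ => by
        ext x
        simp only [ruelle, ContinuousMap.coe_mk, ContinuousMap.smul_apply, smul_eq_mul,
          RingHom.id_apply, ← integral_const_mul]
        refine integral_congr_ae (ae_of_all _ fun a => ?_)
        ring }
  obtain ⟨μ, hμ, hfix⟩ := exists_invariant_probabilityMeasure L
    (fun φ hφ x => integral_nonneg fun a => mul_nonneg (Real.exp_pos _).le (hφ _))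
    (by ext x; exact h1 x)
  have hfix' : ∀ φ : (ℕ → A) → ℝ, Continuous φ → ∫ x, ruelle p ψ φ x ∂μ = ∫ x, φ x ∂μ :=
    fun φ hφ => hfix ⟨φ, hφ⟩
  refine ⟨μ, hμ, ?_, hfix'⟩
  have : IsProbabilityMeasure (μ.map shift) :=
    Measure.isProbabilityMeasure_map continuous_shift.measurable.aemeasurable
  refine ext_of_forall_integral_eq_of_IsFiniteMeasure fun φ => ?_
  rw [integral_map continuous_shift.measurable.aemeasurable φ.continuous.aestronglyMeasurable,
    ← hfix' (fun x => φ (shift x)) (φ.continuous.comp continuous_shift)]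
  refine integral_congr_ae (ae_of_all _ fun x => ?_)
  have := h1 x
  simp only [ruelle, mul_one] at this
  simp only [ruelle, shift_cons, integral_mul_const, this, one_mul]

/-- Finite marginals of a measure fixed by the dual Ruelle operator. -/
theorem map_proj_eq_withDensity (p : Measure A) [IsProbabilityMeasure p] {ψ : (ℕ → A) → ℝ}
    (hψ : Continuous ψ) {μ : Measure (ℕ → A)} [IsProbabilityMeasure μ]
    (hfix : ∀ φ : (ℕ → A) → ℝ, Continuous φ → ∫ x, ruelle p ψ φ x ∂μ = ∫ x, φ x ∂μ) (n : ℕ) :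
    μ.map (proj n) = (Measure.pi fun _ : Fin n => p).withDensity fun a =>
      ENNReal.ofReal (∫ y, Real.exp (birkhoff n ψ (wordCons n a y)) ∂μ) := by
  have hcont : Continuous fun q : (Fin n → A) × (ℕ → A) =>
      Real.exp (birkhoff n ψ (wordCons n q.1 q.2)) :=
    Real.continuous_exp.comp ((continuous_birkhoff n hψ).comp (continuous_wordCons n))
  have hρ : Continuous fun a => ∫ y, Real.exp (birkhoff n ψ (wordCons n a y)) ∂μ := by
    have hint := continuous_parametric_integral_of_continuous (μ := μ)
      (f := fun (a : Fin n → A) y => Real.exp (birkhoff n ψ (wordCons n a y))) hcont isCompact_univ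
    rwa [Measure.restrict_univ] at hint
  have hρ0 : ∀ a, 0 ≤ ∫ y, Real.exp (birkhoff n ψ (wordCons n a y)) ∂μ := fun a =>
    integral_nonneg fun y => (Real.exp_pos _).le
  have : IsProbabilityMeasure (μ.map (proj n)) :=
    Measure.isProbabilityMeasure_map (continuous_proj n).measurable.aemeasurable
  have : IsFiniteMeasure ((Measure.pi fun _ : Fin n => p).withDensity fun a =>
      ENNReal.ofReal (∫ y, Real.exp (birkhoff n ψ (wordCons n a y)) ∂μ)) :=
    isFiniteMeasure_withDensity_ofReal (integrable_of_continuous _ hρ).2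
  have hiter : ∀ (k : ℕ) (φ : (ℕ → A) → ℝ), Continuous φ →
      ∫ x, ((ruelle p ψ)^[k] φ) x ∂μ = ∫ x, φ x ∂μ := fun k => by
    induction k with
    | zero => intro φ _; rfl
    | succ k ih =>
      intro φ hφ
      rw [Function.iterate_succ_apply, ih _ (continuous_ruelle p hψ hφ), hfix φ hφ]
  refine ext_of_forall_integral_eq_of_IsFiniteMeasure fun φ => ?_
  rw [integral_map (continuous_proj n).measurable.aemeasurable φ.continuous.aestronglyMeasurable,
    integral_withDensity_eq_integral_toReal_smul hρ.measurable.ennreal_ofReal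
      (ae_of_all _ fun _ => ENNReal.ofReal_lt_top)]
  have hφ : Continuous fun x : ℕ → A => φ (proj n x) := φ.continuous.comp (continuous_proj n)
  rw [← hiter n _ hφ]
  simp only [ruelle_iterate p hψ n hφ, proj_wordCons]
  rw [integral_integral_swap]
  · refine integral_congr_ae (ae_of_all _ fun a => ?_)
    simp only [integral_mul_const, ENNReal.toReal_ofReal (hρ0 a), smul_eq_mul]
  · exact integrable_of_continuous _
      ((hcont.comp continuous_swap).mul (φ.continuous.comp continuous_snd))

/-- Upper entropy bound for a continuous normalized potential `ψ` with bounded distortion. -/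
theorem finEnt_le (p : Measure A) [IsProbabilityMeasure p] {ψ : (ℕ → A) → ℝ}
    (hψ : Continuous ψ) (h1 : ∀ x, ruelle p ψ (fun _ => 1) x = 1) {K : ℝ}
    (hK : ∀ n x w, (∀ i < n, x i = w i) → |birkhoff n ψ x - birkhoff n ψ w| ≤ K)
    {μ : Measure (ℕ → A)} [IsProbabilityMeasure μ] (hμ : μ.map shift = μ) (n : ℕ) :
    finEnt p μ n ≤ ((K - n * ∫ x, ψ x ∂μ : ℝ) : EReal) := by
  obtain ⟨y⟩ : Nonempty (ℕ → A) := nonempty_of_isProbabilityMeasure μ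
  have : IsProbabilityMeasure (μ.map (proj n)) :=
    Measure.isProbabilityMeasure_map (continuous_proj n).measurable.aemeasurable
  have hg : Continuous fun a : Fin n → A => birkhoff n ψ (wordCons n a y) :=
    (continuous_birkhoff n hψ).comp
      ((continuous_wordCons n).comp (continuous_id.prodMk continuous_const))
  have hone : ∫ a, Real.exp (birkhoff n ψ (wordCons n a y)) ∂(Measure.pi fun _ : Fin n => p) = 1 := by
    have e := ruelle_iterate p hψ n (φ := fun _ => 1) continuous_const y
    rw [Function.iterate_fixed (funext h1)] at e
    simpa using e.symm
  have key := le_relEnt (μ.map (proj n)) (Measure.pi fun _ : Fin n => p)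
    (integrable_of_continuous _ hg) (integrable_of_continuous _ (Real.continuous_exp.comp hg)) hone
  have hle : n * ∫ x, ψ x ∂μ - K
      ≤ ∫ a, birkhoff n ψ (wordCons n a y) ∂(μ.map (proj n)) := by
    rw [integral_map (continuous_proj n).measurable.aemeasurable hg.aestronglyMeasurable,
      ← integral_birkhoff hμ hψ n]
    have hi := integrable_of_continuous μ (continuous_birkhoff n hψ)
    calc ∫ x, birkhoff n ψ x ∂μ - K = ∫ x, (birkhoff n ψ x - K) ∂μ := by
          rw [integral_sub hi (integrable_const K)]; simp
      _ ≤ _ := by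
          refine integral_mono (hi.sub (integrable_const K))
            (integrable_of_continuous μ (hg.comp (continuous_proj n))) fun x => ?_
          have := (abs_le.1 (hK n x (wordCons n (proj n x) y)
            fun i hi => (wordCons_proj_apply hi x y).symm)).2
          simp only
          linarith
  unfold finEnt
  refine (EReal.neg_le_neg_iff.2 ((EReal.coe_le_coe_iff.2 hle).trans key)).trans ?_
  rw [← EReal.coe_neg, neg_sub]

/-- Lower entropy bound for an invariant measure fixed by the dual Ruelle operator. -/
theorem le_finEnt (p : Measure A) [IsProbabilityMeasure p] {ψ : (ℕ → A) → ℝ}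
    (hψ : Continuous ψ) {K : ℝ}
    (hK : ∀ n x w, (∀ i < n, x i = w i) → |birkhoff n ψ x - birkhoff n ψ w| ≤ K)
    {μ : Measure (ℕ → A)} [IsProbabilityMeasure μ] (hμ : μ.map shift = μ)
    (hfix : ∀ φ : (ℕ → A) → ℝ, Continuous φ → ∫ x, ruelle p ψ φ x ∂μ = ∫ x, φ x ∂μ) (n : ℕ) :
    ((-K - n * ∫ x, ψ x ∂μ : ℝ) : EReal) ≤ finEnt p μ n := by
  have : IsProbabilityMeasure (μ.map (proj n)) :=
    Measure.isProbabilityMeasure_map (continuous_proj n).measurable.aemeasurable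
  have hcont : Continuous fun q : (Fin n → A) × (ℕ → A) =>
      Real.exp (birkhoff n ψ (wordCons n q.1 q.2)) :=
    Real.continuous_exp.comp ((continuous_birkhoff n hψ).comp (continuous_wordCons n))
  have hρ : Continuous fun a => ∫ y, Real.exp (birkhoff n ψ (wordCons n a y)) ∂μ := by
    have hint := continuous_parametric_integral_of_continuous (μ := μ)
      (f := fun (a : Fin n → A) y => Real.exp (birkhoff n ψ (wordCons n a y))) hcont isCompact_univ
    rwa [Measure.restrict_univ] at hint
  have hsec : ∀ a, Integrable (fun y => Real.exp (birkhoff n ψ (wordCons n a y))) μ := fun a =>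
    integrable_of_continuous μ (hcont.comp (continuous_const.prodMk continuous_id))
  have hρpos : ∀ a, 0 < ∫ y, Real.exp (birkhoff n ψ (wordCons n a y)) ∂μ := fun a =>
    integral_exp_pos (hsec a)
  have hlog : Continuous fun a => Real.log (∫ y, Real.exp (birkhoff n ψ (wordCons n a y)) ∂μ) :=
    hρ.log fun a => (hρpos a).ne'
  have hle : ∫ a, Real.log (∫ y, Real.exp (birkhoff n ψ (wordCons n a y)) ∂μ) ∂(μ.map (proj n))
      ≤ n * ∫ x, ψ x ∂μ + K := by
    rw [integral_map (continuous_proj n).measurable.aemeasurable hlog.aestronglyMeasurable,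
      ← integral_birkhoff hμ hψ n]
    have hi := integrable_of_continuous μ (continuous_birkhoff n hψ)
    calc _ ≤ ∫ x, (birkhoff n ψ x + K) ∂μ := by
          refine integral_mono (integrable_of_continuous μ (hlog.comp (continuous_proj n)))
            (hi.add (integrable_const K)) fun x => ?_
          simp only
          rw [Real.log_le_iff_le_exp (hρpos _)]
          calc _ ≤ ∫ _, Real.exp (birkhoff n ψ x + K) ∂μ := by
                refine integral_mono (hsec _) (integrable_const _) fun y => ?_
                have := (abs_le.1 (hK n x (wordCons n (proj n x) y)
                  fun i hi => (wordCons_proj_apply hi x y).symm)).1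
                exact Real.exp_le_exp.2 (by linarith)
            _ = _ := by simp
      _ = ∫ x, birkhoff n ψ x ∂μ + K := by
          rw [integral_add hi (integrable_const K)]; simp
  unfold finEnt
  rw [relEnt_withDensity _ hρ hρpos (map_proj_eq_withDensity p hψ hfix n), ← EReal.coe_neg,
    EReal.coe_le_coe_iff]
  linarith

omit [MetricSpace A] [CompactSpace A] [BorelSpace A] in
theorem specEnt_le (p : Measure A) {μ : Measure (ℕ → A)} {K c : ℝ}
    (hc : ∀ n : ℕ, finEnt p μ n ≤ ((K + n * c : ℝ) : EReal)) : specEnt p μ ≤ (c : EReal) := by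
  have hlim : Tendsto (fun n : ℕ => ((K / n + c : ℝ) : EReal)) atTop (nhds (c : EReal)) := by
    refine (continuous_coe_real_ereal.tendsto c).comp ?_
    simpa using (tendsto_const_div_atTop_nhds_zero_nat K).add_const c
  rw [← hlim.limsup_eq]
  refine limsup_le_limsup ?_
  filter_upwards [eventually_gt_atTop 0] with n hn
  have hn' : (n : ℝ) ≠ 0 := by positivity
  rw [← EReal.coe_inv]
  refine (mul_le_mul_of_nonneg_left (hc n) (EReal.coe_nonneg.2 (by positivity))).trans ?_
  rw [← EReal.coe_mul, EReal.coe_le_coe_iff]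
  apply le_of_eq
  field_simp

omit [MetricSpace A] [CompactSpace A] [BorelSpace A] in
theorem le_specEnt (p : Measure A) {μ : Measure (ℕ → A)} {K c : ℝ}
    (hc : ∀ n : ℕ, ((K + n * c : ℝ) : EReal) ≤ finEnt p μ n) : (c : EReal) ≤ specEnt p μ := by
  have hlim : Tendsto (fun n : ℕ => ((K / n + c : ℝ) : EReal)) atTop (nhds (c : EReal)) := by
    refine (continuous_coe_real_ereal.tendsto c).comp ?_
    simpa using (tendsto_const_div_atTop_nhds_zero_nat K).add_const c
  rw [← hlim.limsup_eq]
  refine limsup_le_limsup ?_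
  filter_upwards [eventually_gt_atTop 0] with n hn
  have hn' : (n : ℝ) ≠ 0 := by positivity
  rw [← EReal.coe_inv]
  refine le_trans ?_ (mul_le_mul_of_nonneg_left (hc n) (EReal.coe_nonneg.2 (by positivity)))
  rw [← EReal.coe_mul, EReal.coe_le_coe_iff]
  apply le_of_eq
  field_simp

omit [CompactSpace A] [MeasurableSpace A] [BorelSpace A] in
theorem dOmega_term_nonneg (x y : ℕ → A) (i : ℕ) :
    0 ≤ (1 / 2 : ℝ) ^ (i + 1) * (dist (x i) (y i) / (1 + dist (x i) (y i))) := by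
  positivity

omit [CompactSpace A] [MeasurableSpace A] [BorelSpace A] in
theorem dOmega_term_le (x y : ℕ → A) (i : ℕ) :
    (1 / 2 : ℝ) ^ (i + 1) * (dist (x i) (y i) / (1 + dist (x i) (y i))) ≤ (1 / 2) ^ (i + 1) := by
  refine mul_le_of_le_one_right (by positivity) ?_
  rw [div_le_one (by positivity)]
  linarith

theorem summable_half_pow_succ : Summable fun i : ℕ => (1 / 2 : ℝ) ^ (i + 1) :=
  (summable_nat_add_iff 1).2 (summable_geometric_of_lt_one (by norm_num) (by norm_num))

theorem tsum_half_pow_succ : ∑' i : ℕ, (1 / 2 : ℝ) ^ (i + 1) = 1 := by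
  simp only [pow_succ, tsum_mul_right, tsum_geometric_two]
  norm_num

omit [CompactSpace A] [MeasurableSpace A] [BorelSpace A] in
theorem summable_dOmega (x y : ℕ → A) :
    Summable fun i : ℕ => (1 / 2 : ℝ) ^ (i + 1) * (dist (x i) (y i) / (1 + dist (x i) (y i))) :=
  Summable.of_nonneg_of_le (dOmega_term_nonneg x y) (dOmega_term_le x y) summable_half_pow_succ

omit [CompactSpace A] [MeasurableSpace A] [BorelSpace A] in
theorem dOmega_nonneg (x y : ℕ → A) : 0 ≤ dOmega x y :=
  tsum_nonneg (dOmega_term_nonneg x y)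

omit [CompactSpace A] [MeasurableSpace A] [BorelSpace A] in
theorem dOmega_self (x : ℕ → A) : dOmega x x = 0 := by
  simp [dOmega]

omit [CompactSpace A] [MeasurableSpace A] [BorelSpace A] in
theorem dOmega_le_of_agree {n : ℕ} {x y : ℕ → A} (hxy : ∀ i < n, x i = y i) :
    dOmega x y ≤ (1 / 2) ^ n := by
  unfold dOmega
  rw [← (summable_dOmega x y).sum_add_tsum_nat_add n]
  have h0 : ∑ i ∈ Finset.range n,
      (1 / 2 : ℝ) ^ (i + 1) * (dist (x i) (y i) / (1 + dist (x i) (y i))) = 0 :=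
    Finset.sum_eq_zero fun i hi => by simp [hxy i (Finset.mem_range.1 hi)]
  have heq : ∀ i : ℕ, (1 / 2 : ℝ) ^ (i + n + 1) = (1 / 2) ^ n * (1 / 2) ^ (i + 1) := fun i => by
    ring
  rw [h0, zero_add]
  calc _ ≤ ∑' i : ℕ, (1 / 2 : ℝ) ^ (i + n + 1) :=
        ((summable_nat_add_iff n).2 (summable_dOmega x y)).tsum_le_tsum
          (fun i => dOmega_term_le x y (i + n)) ((summable_nat_add_iff n).2 summable_half_pow_succ)
    _ = (1 / 2) ^ n := by simp only [heq, tsum_mul_left, tsum_half_pow_succ, mul_one]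

omit [CompactSpace A] [MeasurableSpace A] [BorelSpace A] in
theorem continuous_dOmega_left (y : ℕ → A) : Continuous fun x => dOmega x y := by
  unfold dOmega
  refine continuous_tsum (fun i => ?_) summable_half_pow_succ fun i x => ?_
  · have hd : Continuous fun x : ℕ → A => dist (x i) (y i) :=
      (continuous_apply i).dist continuous_const
    exact continuous_const.mul (hd.div (continuous_const.add hd) fun x => by positivity)
  · rw [Real.norm_of_nonneg (dOmega_term_nonneg x y i)]
    exact dOmega_term_le x y i

omit [CompactSpace A] [MeasurableSpace A] [BorelSpace A] in
theorem IsHolder.continuous {α : ℝ} (hα : 0 < α) {f : (ℕ → A) → ℝ} (hf : IsHolder α f) :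
    Continuous f := by
  obtain ⟨C, -, hC⟩ := hf
  refine continuous_iff_continuousAt.2 fun y => ?_
  refine tendsto_iff_dist_tendsto_zero.2 ?_
  have hlim : Tendsto (fun x => C * dOmega x y ^ α) (nhds y) (nhds 0) := by
    have hc : Continuous fun x => C * dOmega x y ^ α :=
      continuous_const.mul ((continuous_dOmega_left y).rpow_const fun _ => Or.inr hα.le)
    simpa [dOmega_self, Real.zero_rpow hα.ne'] using hc.tendsto y
  exact squeeze_zero (fun _ => dist_nonneg) (fun x => hC x y) hlim

omit [CompactSpace A] [MeasurableSpace A] [BorelSpace A] in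
/-- Birkhoff sums of a Hölder potential have bounded distortion on cylinders. -/
theorem IsHolder.exists_birkhoff_distortion {α : ℝ} (hα : 0 < α) {f : (ℕ → A) → ℝ}
    (hf : IsHolder α f) :
    ∃ K : ℝ, ∀ n x w, (∀ i < n, x i = w i) → |birkhoff n f x - birkhoff n f w| ≤ K := by
  obtain ⟨C, hC0, hC⟩ := hf
  set r : ℝ := (1 / 2 : ℝ) ^ α with hr
  have hr0 : 0 ≤ r := by positivity
  have hr1 : r < 1 := Real.rpow_lt_one (by norm_num) (by norm_num) hα
  refine ⟨C * (1 - r)⁻¹, fun n x w hxw => ?_⟩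
  have hiter : ∀ (k : ℕ) (z : ℕ → A) (i : ℕ), (shift^[k] z) i = z (i + k) := fun k => by
    induction k with
    | zero => intro z i; rfl
    | succ k ih =>
      intro z i
      rw [Function.iterate_succ_apply, ih]
      rfl
  have hterm : ∀ k ∈ Finset.range n, |f (shift^[k] x) - f (shift^[k] w)| ≤ C * r ^ (n - k) := by
    intro k hk
    have hk' := Finset.mem_range.1 hk
    refine (hC _ _).trans (mul_le_mul_of_nonneg_left ?_ hC0)
    have hd : dOmega (shift^[k] x) (shift^[k] w) ≤ (1 / 2) ^ (n - k) :=
      dOmega_le_of_agree fun i hi => by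
        rw [hiter, hiter]
        exact hxw _ (by omega)
    refine (Real.rpow_le_rpow (dOmega_nonneg _ _) hd hα.le).trans_eq ?_
    rw [hr, ← Real.rpow_natCast, ← Real.rpow_natCast, ← Real.rpow_mul (by norm_num),
      ← Real.rpow_mul (by norm_num), mul_comm]
  have hgeom : ∑ k ∈ Finset.range n, r ^ (n - k) ≤ (1 - r)⁻¹ := by
    rw [← tsum_geometric_of_lt_one hr0 hr1]
    calc ∑ k ∈ Finset.range n, r ^ (n - k) ≤ ∑ k ∈ Finset.range (n + 1), r ^ (n - k) :=
          Finset.sum_le_sum_of_subset_of_nonneg (Finset.range_mono n.le_succ)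
            fun _ _ _ => by positivity
      _ = ∑ k ∈ Finset.range (n + 1), r ^ k := by
          rw [← Finset.sum_range_reflect]
          exact Finset.sum_congr rfl fun k hk => by
            have := Finset.mem_range.1 hk
            congr 1; omega
      _ ≤ _ := (summable_geometric_of_lt_one hr0 hr1).sum_le_tsum _ fun _ _ => by positivity
  simp only [birkhoff, ← Finset.sum_sub_distrib]
  refine (Finset.abs_sum_le_sum_abs _ _).trans ((Finset.sum_le_sum hterm).trans ?_)
  rw [← Finset.mul_sum]
  exact mul_le_mul_of_nonneg_left hgeom hC0

omit [MetricSpace A] [CompactSpace A] [MeasurableSpace A] [BorelSpace A] in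
theorem birkhoff_fbar (f h : (ℕ → A) → ℝ) (lam : ℝ) (n : ℕ) (x : ℕ → A) :
    birkhoff n (fbar f h lam) x = birkhoff n f x + Real.log (h x)
      - Real.log (h (shift^[n] x)) - n * Real.log lam := by
  induction n with
  | zero => simp [birkhoff]
  | succ n ih =>
    simp only [birkhoff, Finset.sum_range_succ] at ih ⊢
    rw [ih, fbar, ← Function.iterate_succ_apply' shift]
    push_cast
    ring

omit [MetricSpace A] [CompactSpace A] [BorelSpace A] in
theorem ruelle_fbar_one (p : Measure A) {f h : (ℕ → A) → ℝ} {lam : ℝ} (hlam : 0 < lam)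
    (hpos : ∀ x, 0 < h x) (heig : ∀ x, ruelle p f h x = lam * h x) (x : ℕ → A) :
    ruelle p (fbar f h lam) (fun _ => 1) x = 1 := by
  have hx := (hpos x).ne'
  have he : ∀ a, Real.exp (fbar f h lam (cons a x)) * 1
      = Real.exp (f (cons a x)) * h (cons a x) * (lam * h x)⁻¹ := fun a => by
    rw [fbar, shift_cons, Real.exp_sub, Real.exp_sub, Real.exp_add, Real.exp_log (hpos _),
      Real.exp_log (hpos _), Real.exp_log hlam]
    field_simp
  have e := heig x
  simp only [ruelle] at e
  simp only [ruelle, he, integral_mul_const, e]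
  exact mul_inv_cancel₀ (mul_pos hlam (hpos x)).ne'

omit [MeasurableSpace A] [BorelSpace A] in
theorem exists_birkhoff_fbar_distortion {α : ℝ} (hα : 0 < α) {f h : (ℕ → A) → ℝ}
    (hf : IsHolder α f) (hh : IsHolder α h) (hpos : ∀ x, 0 < h x) (lam : ℝ) :
    ∃ K : ℝ, ∀ n x w, (∀ i < n, x i = w i) →
      |birkhoff n (fbar f h lam) x - birkhoff n (fbar f h lam) w| ≤ K := by
  obtain ⟨K, hK⟩ := hf.exists_birkhoff_distortion hα
  obtain ⟨M, hM⟩ := isCompact_univ.exists_bound_of_continuousOn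
    ((hh.continuous hα).log fun x => (hpos x).ne').continuousOn
  refine ⟨K + 4 * M, fun n x w hxw => ?_⟩
  have hM' : ∀ z, -M ≤ Real.log (h z) ∧ Real.log (h z) ≤ M := fun z =>
    abs_le.1 (hM z (Set.mem_univ z))
  have hb := abs_le.1 (hK n x w hxw)
  have m1 := hM' x
  have m2 := hM' w
  have m3 := hM' (shift^[n] x)
  have m4 := hM' (shift^[n] w)
  rw [birkhoff_fbar, birkhoff_fbar, abs_le]
  constructor <;> linarith [hb.1, hb.2, m1.1, m1.2, m2.1, m2.2, m3.1, m3.2, m4.1, m4.2]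

theorem integral_fbar {f h : (ℕ → A) → ℝ} (hf : Continuous f) (hh : Continuous h)
    (hpos : ∀ x, 0 < h x) (lam : ℝ) {μ : Measure (ℕ → A)} [IsProbabilityMeasure μ]
    (hμ : μ.map shift = μ) :
    ∫ x, fbar f h lam x ∂μ = ∫ x, f x ∂μ - Real.log lam := by
  have hl : Continuous fun x => Real.log (h x) := hh.log fun x => (hpos x).ne'
  have i1 := integrable_of_continuous μ hf
  have i2 := integrable_of_continuous μ hl
  have i3 : Integrable (fun x => Real.log (h (shift x))) μ :=
    integrable_of_continuous μ (hl.comp continuous_shift)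
  have e : ∫ x, Real.log (h (shift x)) ∂μ = ∫ x, Real.log (h x) ∂μ := by
    conv_rhs => rw [← hμ]
    rw [integral_map continuous_shift.measurable.aemeasurable hl.aestronglyMeasurable]
  simp only [fbar]
  have i12 : Integrable (fun x => f x + Real.log (h x)) μ := i1.add i2
  have i123 : Integrable (fun x => f x + Real.log (h x) - Real.log (h (shift x))) μ := i12.sub i3
  rw [integral_sub i123 (integrable_const _), integral_sub i12 i3,
    integral_add i1 i2, e]
  simp

/-- If `f` is `α`-Hölder and `L_f h = λ h` with `λ > 0` and `h` strictly
positive `α`-Hölder, then the variational principle for the specific entropy holds: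
`log λ = sup { h^s(μ) + ∫ f dμ : μ shift-invariant Borel probability measure }`. -/
theorem statement19
    (p : Measure A) [IsProbabilityMeasure p]
    (hsupp : ∀ U : Set A, IsOpen U → U.Nonempty → 0 < p U)
    (α : ℝ) (hα0 : 0 < α) (hα1 : α < 1)
    (f : (ℕ → A) → ℝ) (hf : IsHolder α f)
    (lam : ℝ) (hlam : 0 < lam)
    (h : (ℕ → A) → ℝ) (hh : IsHolder α h) (hpos : ∀ x, 0 < h x)
    (heig : ∀ x, ruelle p f h x = lam * h x) :
    ((Real.log lam : ℝ) : EReal)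
      = sSup {c : EReal | ∃ μ : Measure (ℕ → A), IsProbabilityMeasure μ ∧
          μ.map shift = μ ∧ c = specEnt p μ + ((∫ x, f x ∂μ : ℝ) : EReal)} := by
  have hfc := hf.continuous hα0
  have hhc := hh.continuous hα0
  have hψ : Continuous (fbar f h lam) := by
    have hl : Continuous fun x => Real.log (h x) := hhc.log fun x => (hpos x).ne'
    exact ((hfc.add hl).sub (hl.comp continuous_shift)).sub continuous_const
  have h1 := ruelle_fbar_one p hlam hpos heig
  obtain ⟨K, hK⟩ := exists_birkhoff_fbar_distortion hα0 hf hh hpos lam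
  have upper : ∀ μ : Measure (ℕ → A), IsProbabilityMeasure μ → μ.map shift = μ →
      specEnt p μ ≤ ((Real.log lam - ∫ x, f x ∂μ : ℝ) : EReal) := fun μ _ hμ =>
    specEnt_le p (K := K) fun n => by
      refine (finEnt_le p hψ h1 hK hμ n).trans_eq ?_
      rw [integral_fbar hfc hhc hpos lam hμ]
      congr 1
      ring
  refine le_antisymm ?_ (sSup_le ?_)
  · obtain ⟨μ, hprob, hμ, hfix⟩ := exists_dual_fixed p hψ h1
    have lower : ((Real.log lam - ∫ x, f x ∂μ : ℝ) : EReal) ≤ specEnt p μ :=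
      le_specEnt p (K := -K) fun n => by
        refine le_of_eq_of_le ?_ (le_finEnt p hψ hK hμ hfix n)
        rw [integral_fbar hfc hhc hpos lam hμ]
        congr 1
        ring
    refine le_sSup ⟨μ, hprob, hμ, ?_⟩
    rw [le_antisymm (upper μ hprob hμ) lower, ← EReal.coe_add, sub_add_cancel]
  · rintro c ⟨μ, hprob, hμ, rfl⟩
    refine (add_le_add_left (upper μ hprob hμ) _).trans_eq ?_
    rw [← EReal.coe_add, sub_add_cancel]

end Paper
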